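/- Let N be a quantum channel and T a degradable extension of N (an additive extension of N that is degradable). Then the private classical capacity of N satisfies C_p(N) ≤ Q^(1)(T). -/

import Mathlib

open scoped Matrix Kronecker ComplexOrder

/-- A finite family of Kraus operators from input space `A` to output space `B`. -/
structure KrausFamily (A B : Type) [Fintype A] [DecidableEq A] [Fintype B] [DecidableEq B] :
    Type 1 where
  ι : Type
  [fι : Fintype ι]
  [dι : DecidableEq ι]
  K : ι → Matrix B A ℂ

attribute [instance] KrausFamily.fι KrausFamily.dι

variable {A B : Type} [Fintype A] [DecidableEq A] [Fintype B] [DecidableEq B]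

/-- The trace-preservation condition `Σ Kᵢ† Kᵢ = 1` making a Kraus family a quantum channel. -/
def KrausFamily.IsChannel (N : KrausFamily A B) : Prop :=
  ∑ i, (N.K i)ᴴ * N.K i = 1

/-- The action of a channel: `N(ρ) = Σ Kᵢ ρ Kᵢ†`. -/
noncomputable def KrausFamily.apply (N : KrausFamily A B) (ρ : Matrix A A ℂ) : Matrix B B ℂ :=
  ∑ i, N.K i * ρ * (N.K i)ᴴ

/-- The complementary channel: `N̂(ρ)ᵢⱼ = Tr (Kᵢ ρ Kⱼ†)`. -/
noncomputable def KrausFamily.compl (N : KrausFamily A B) (ρ : Matrix A A ℂ) :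
    Matrix N.ι N.ι ℂ :=
  Matrix.of fun i j => (N.K i * ρ * (N.K j)ᴴ).trace

/-- Von Neumann entropy, base 2: `S(ρ) = −Σ λⱼ log₂ λⱼ` over the eigenvalues of `ρ`
(junk value `0` for non-Hermitian matrices). -/
noncomputable def vnEntropy {n : Type} [Fintype n] [DecidableEq n] (ρ : Matrix n n ℂ) : ℝ :=
  if h : ρ.IsHermitian then -∑ j, h.eigenvalues j * Real.logb 2 (h.eigenvalues j) else 0

/-- A density matrix: positive semidefinite with unit trace. -/
def IsDensity {n : Type} [Fintype n] (ρ : Matrix n n ℂ) : Prop :=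
  ρ.PosSemidef ∧ ρ.trace = 1

/-- Coherent information of `N` at input `φ`: `I^c(N,φ) = S(N(φ)) − S(N̂(φ))`. -/
noncomputable def cohInfo (N : KrausFamily A B) (φ : Matrix A A ℂ) : ℝ :=
  vnEntropy (N.apply φ) - vnEntropy (N.compl φ)

/-- One-shot quantum capacity: `Q^{(1)}(N) = sup_φ I^c(N,φ)` over density matrices `φ`. -/
noncomputable def Q1 (N : KrausFamily A B) : ℝ :=
  sSup {x | ∃ φ : Matrix A A ℂ, IsDensity φ ∧ x = cohInfo N φ}

/-- The `n`-th tensor power of a Kraus family, whose Kraus operators are all `n`-fold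
Kronecker products of Kraus operators of `N`. -/
noncomputable def KrausFamily.pow (N : KrausFamily A B) (n : ℕ) :
    KrausFamily (Fin n → A) (Fin n → B) where
  ι := Fin n → N.ι
  K f := Matrix.of fun b a => ∏ i, N.K (f i) (b i) (a i)

/-- Quantum capacity: `Q(N) = sup_{n ≥ 1} (1/n) Q^{(1)}(N^{⊗n})`. -/
noncomputable def Qcap (N : KrausFamily A B) : ℝ :=
  sSup {x | ∃ n : ℕ, 0 < n ∧ x = (1 / (n : ℝ)) * Q1 (N.pow n)}

/-- `N` is degradable if some channel `D` maps its output to its complementary output. -/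
def KrausFamily.IsDegradable (N : KrausFamily A B) : Prop :=
  ∃ D : KrausFamily B N.ι, D.IsChannel ∧ ∀ ρ : Matrix A A ℂ, D.apply (N.apply ρ) = N.compl ρ

/-- `N` is antidegradable if some channel `D` maps its complementary output to its output. -/
def KrausFamily.IsAntidegradable (N : KrausFamily A B) : Prop :=
  ∃ D : KrausFamily N.ι B, D.IsChannel ∧ ∀ ρ : Matrix A A ℂ, D.apply (N.compl ρ) = N.apply ρ

section Private

variable {A B : Type} [Fintype A] [DecidableEq A] [Fintype B] [DecidableEq B]

/-- The classical–quantum–quantum state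
`ω_{TBE} = Σ_{x,t} p(t|x) pₓ |t⟩⟨t|_T ⊗ U|φₓ⟩⟨φₓ|U†`, where `U` is the isometric
extension `U|ψ⟩ = Σᵢ Kᵢ|ψ⟩ ⊗ |i⟩_E` of the channel `N`. -/
noncomputable def privState (N : KrausFamily A B) {nX nT : ℕ}
    (p : Fin nX → ℝ) (φ : Fin nX → (A → ℂ)) (pt : Fin nT → Fin nX → ℝ) :
    Matrix (Fin nT × B × N.ι) (Fin nT × B × N.ι) ℂ :=
  Matrix.of fun z w =>
    if z.1 = w.1 then
      ∑ x, ((pt z.1 x * p x : ℝ) : ℂ) *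
        ((N.K z.2.2 *ᵥ φ x) z.2.1 * star ((N.K w.2.2 *ᵥ φ x) w.2.1))
    else 0

variable {T E : Type} [Fintype T] [Fintype E]

/-- Reduced state on the first two factors of a tripartite system. -/
noncomputable def red12 (ω : Matrix (T × B × E) (T × B × E) ℂ) : Matrix (T × B) (T × B) ℂ :=
  Matrix.of fun z w => ∑ e, ω (z.1, z.2, e) (w.1, w.2, e)

/-- Reduced state on the first and third factors of a tripartite system. -/
noncomputable def red13 (ω : Matrix (T × B × E) (T × B × E) ℂ) : Matrix (T × E) (T × E) ℂ :=
  Matrix.of fun z w => ∑ b, ω (z.1, b, z.2) (w.1, b, w.2)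

/-- Reduced state on the first factor of a tripartite system. -/
noncomputable def red1 (ω : Matrix (T × B × E) (T × B × E) ℂ) : Matrix T T ℂ :=
  Matrix.of fun t t' => ∑ b, ∑ e, ω (t, b, e) (t', b, e)

/-- Reduced state on the second factor of a tripartite system. -/
noncomputable def red2 (ω : Matrix (T × B × E) (T × B × E) ℂ) : Matrix B B ℂ :=
  Matrix.of fun b b' => ∑ t, ∑ e, ω (t, b, e) (t, b', e)

/-- Reduced state on the third factor of a tripartite system. -/
noncomputable def red3 (ω : Matrix (T × B × E) (T × B × E) ℂ) : Matrix E E ℂ :=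
  Matrix.of fun e e' => ∑ t, ∑ b, ω (t, b, e) (t, b, e')

/-- The one-shot private information
`C_p^{(1)}(N) = sup ( I(T;B)_ω − I(T;E)_ω )`, the supremum running over finite ensembles
`{pₓ, |φₓ⟩}` of pure input states and stochastic maps `p(t|x)`, with
`I(T;B)_ω = S(ω_T) + S(ω_B) − S(ω_{TB})` evaluated on the state `ω = privState N p φ pt`. -/
noncomputable def Cp1 (N : KrausFamily A B) : ℝ :=
  sSup {r | ∃ (nX nT : ℕ) (p : Fin nX → ℝ) (φ : Fin nX → (A → ℂ))
      (pt : Fin nT → Fin nX → ℝ),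
    (∀ x, 0 ≤ p x) ∧ (∑ x, p x = 1) ∧
    (∀ x, ∑ a, ‖φ x a‖ ^ 2 = 1) ∧
    (∀ t x, 0 ≤ pt t x) ∧ (∀ x, ∑ t, pt t x = 1) ∧
    r = (vnEntropy (red1 (privState N p φ pt)) + vnEntropy (red2 (privState N p φ pt))
          - vnEntropy (red12 (privState N p φ pt)))
      - (vnEntropy (red1 (privState N p φ pt)) + vnEntropy (red3 (privState N p φ pt))
          - vnEntropy (red13 (privState N p φ pt)))}

/-- The private classical capacity `C_p(N) = sup_{n ≥ 1} (1/n) C_p^{(1)}(N^{⊗n})`. -/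
noncomputable def Cp (N : KrausFamily A B) : ℝ :=
  sSup {x | ∃ n : ℕ, 0 < n ∧ x = (1 / (n : ℝ)) * Cp1 (N.pow n)}

end Private

section RelativeEntropy

/-- The concave quadratic form whose maximum over `X` is `⟨ρ, (L_σ + s R_ρ)⁻¹ ρ⟩`. -/
noncomputable def quadForm (s : ℝ) (ρ σ X : Matrix A A ℂ) : ℝ :=
  2 * (Xᴴ * ρ).trace.re - (σ * (X * Xᴴ)).trace.re - s * (ρ * (Xᴴ * X)).trace.re

/-- The Heisenberg-picture adjoint of a Kraus family. -/
noncomputable def KrausFamily.dual (M : KrausFamily A B) (X : Matrix B B ℂ) : Matrix A A ℂ :=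
  ∑ i, (M.K i)ᴴ * X * M.K i

lemma KrausFamily.dual_conjTranspose (M : KrausFamily A B) (X : Matrix B B ℂ) :
    (M.dual X)ᴴ = M.dual Xᴴ := by
  simp [KrausFamily.dual, Matrix.conjTranspose_sum, Matrix.mul_assoc]

lemma KrausFamily.trace_dual_mul (M : KrausFamily A B) (X : Matrix B B ℂ) (ρ : Matrix A A ℂ) :
    (M.dual X * ρ).trace = (X * M.apply ρ).trace := by
  simp only [KrausFamily.dual, KrausFamily.apply, Matrix.sum_mul, Matrix.mul_sum,
    Matrix.trace_sum]
  refine Finset.sum_congr rfl fun i _ => ?_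
  rw [Matrix.mul_assoc, Matrix.mul_assoc, Matrix.trace_mul_comm]
  simp only [Matrix.mul_assoc]

lemma Matrix.PosSemidef.re_trace_nonneg {ρ : Matrix A A ℂ} (h : ρ.PosSemidef) :
    0 ≤ ρ.trace.re :=
  (Complex.le_def.1 h.trace_nonneg).1

/-- The Kadison–Schwarz inequality, tested against a positive semidefinite matrix. -/
lemma KrausFamily.kadison_schwarz (M : KrausFamily A B) (hM : M.IsChannel)
    {σ : Matrix A A ℂ} (hσ : σ.PosSemidef) (X : Matrix B B ℂ) :
    (σ * (M.dual X * (M.dual X)ᴴ)).trace.re ≤ (M.apply σ * (X * Xᴴ)).trace.re := by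
  set Y := M.dual X with hY
  have h0 : 0 ≤ (∑ k, ((Xᴴ * M.K k - M.K k * Yᴴ) * σ *
      (Xᴴ * M.K k - M.K k * Yᴴ)ᴴ)).trace.re :=
    (Matrix.posSemidef_sum _ fun k _ => hσ.mul_mul_conjTranspose_same _).re_trace_nonneg
  have h1 : ∑ k, ((Xᴴ * M.K k - M.K k * Yᴴ)ᴴ * (Xᴴ * M.K k - M.K k * Yᴴ)) =
      M.dual (X * Xᴴ) - Y * Yᴴ := by
    have e : ∀ k, (Xᴴ * M.K k - M.K k * Yᴴ)ᴴ * (Xᴴ * M.K k - M.K k * Yᴴ) =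
        (M.K k)ᴴ * (X * Xᴴ) * M.K k - ((M.K k)ᴴ * X * M.K k) * Yᴴ
        - Y * ((M.K k)ᴴ * Xᴴ * M.K k) + Y * ((M.K k)ᴴ * M.K k) * Yᴴ := by
      intro k
      simp only [Matrix.conjTranspose_sub, Matrix.conjTranspose_mul,
        Matrix.conjTranspose_conjTranspose, Matrix.sub_mul, Matrix.mul_sub, Matrix.mul_assoc]
      abel
    have hM' : ∑ k, (M.K k)ᴴ * M.K k = 1 := hM
    simp only [e, Finset.sum_add_distrib, Finset.sum_sub_distrib, ← Finset.sum_mul,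
      ← Finset.mul_sum, hM']
    have e2 : ∑ k, (M.K k)ᴴ * X * M.K k = Y := rfl
    have e3 : ∑ k, (M.K k)ᴴ * Xᴴ * M.K k = Yᴴ := (M.dual_conjTranspose X).symm
    rw [e2, e3, mul_one]
    simp [KrausFamily.dual]
  have h2 : (∑ k, ((Xᴴ * M.K k - M.K k * Yᴴ) * σ *
      (Xᴴ * M.K k - M.K k * Yᴴ)ᴴ)).trace = ((M.dual (X * Xᴴ) - Y * Yᴴ) * σ).trace := by
    rw [← h1, Finset.sum_mul, Matrix.trace_sum, Matrix.trace_sum]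
    refine Finset.sum_congr rfl fun k _ => ?_
    rw [Matrix.trace_mul_comm, Matrix.mul_assoc]
  rw [h2, Matrix.sub_mul, Matrix.trace_sub, M.trace_dual_mul, Complex.sub_re] at h0
  rw [Matrix.trace_mul_comm σ, Matrix.trace_mul_comm (M.apply σ)]
  linarith

lemma quadForm_apply_le (M : KrausFamily A B) (hM : M.IsChannel) {ρ σ : Matrix A A ℂ}
    (hρ : ρ.PosSemidef) (hσ : σ.PosSemidef) {s : ℝ} (hs : 0 ≤ s) (X : Matrix B B ℂ) :
    quadForm s (M.apply ρ) (M.apply σ) X ≤ quadForm s ρ σ (M.dual X) := by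
  have h1 := M.kadison_schwarz hM hσ X
  have h2 := M.kadison_schwarz hM hρ Xᴴ
  rw [← M.dual_conjTranspose, Matrix.conjTranspose_conjTranspose,
    Matrix.conjTranspose_conjTranspose] at h2
  have h3 := mul_le_mul_of_nonneg_left h2 hs
  unfold quadForm
  rw [M.dual_conjTranspose, M.trace_dual_mul, ← M.dual_conjTranspose]
  linarith

lemma quadForm_diagonal (s : ℝ) {U V : Matrix A A ℂ} (hU : Uᴴ * U = 1) (hV : Vᴴ * V = 1)
    (μ r : A → ℝ) (Z : Matrix A A ℂ) :
    quadForm s (V * Matrix.diagonal (fun j => (r j : ℂ)) * Vᴴ)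
      (U * Matrix.diagonal (fun i => (μ i : ℂ)) * Uᴴ) (U * Z * Vᴴ) =
    ∑ i, ∑ j, (2 * ((star (Z i j) * (Uᴴ * V) i j).re * r j)
      - ‖Z i j‖ ^ 2 * (μ i + s * r j)) := by
  have t1 : ((U * Z * Vᴴ)ᴴ * (V * Matrix.diagonal (fun j => (r j : ℂ)) * Vᴴ)).trace =
      ((Uᴴ * V) * Matrix.diagonal (fun j => (r j : ℂ)) * Zᴴ).trace := by
    have : (U * Z * Vᴴ)ᴴ * (V * Matrix.diagonal (fun j => (r j : ℂ)) * Vᴴ) =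
      V * (Zᴴ * (Uᴴ * V) * Matrix.diagonal (fun j => (r j : ℂ)) * Vᴴ) := by
      simp only [Matrix.conjTranspose_mul, Matrix.conjTranspose_conjTranspose, Matrix.mul_assoc]
    rw [this, Matrix.trace_mul_comm]
    simp only [Matrix.mul_assoc, hV, Matrix.mul_one]
    rw [Matrix.trace_mul_comm]
    simp only [Matrix.mul_assoc]
  have t2 : (U * Matrix.diagonal (fun i => (μ i : ℂ)) * Uᴴ *
      ((U * Z * Vᴴ) * (U * Z * Vᴴ)ᴴ)).trace =
      (Matrix.diagonal (fun i => (μ i : ℂ)) * Z * Zᴴ).trace := by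
    have : U * Matrix.diagonal (fun i => (μ i : ℂ)) * Uᴴ *
      ((U * Z * Vᴴ) * (U * Z * Vᴴ)ᴴ) =
      U * (Matrix.diagonal (fun i => (μ i : ℂ)) * (Uᴴ * U) * Z * (Vᴴ * V) * Zᴴ * Uᴴ) := by
      simp only [Matrix.conjTranspose_mul, Matrix.conjTranspose_conjTranspose, Matrix.mul_assoc]
    rw [this, Matrix.trace_mul_comm, hU, hV]
    simp only [Matrix.mul_assoc, hU, Matrix.mul_one]
  have t3 : (V * Matrix.diagonal (fun j => (r j : ℂ)) * Vᴴ *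
      ((U * Z * Vᴴ)ᴴ * (U * Z * Vᴴ))).trace =
      (Z * Matrix.diagonal (fun j => (r j : ℂ)) * Zᴴ).trace := by
    have : V * Matrix.diagonal (fun j => (r j : ℂ)) * Vᴴ *
      ((U * Z * Vᴴ)ᴴ * (U * Z * Vᴴ)) =
      V * (Matrix.diagonal (fun j => (r j : ℂ)) * (Vᴴ * V) * Zᴴ * (Uᴴ * U) * Z * Vᴴ) := by
      simp only [Matrix.conjTranspose_mul, Matrix.conjTranspose_conjTranspose, Matrix.mul_assoc]
    rw [this, Matrix.trace_mul_comm, hU, hV]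
    simp only [Matrix.mul_assoc, hV, Matrix.mul_one]
    rw [← Matrix.mul_assoc, Matrix.trace_mul_comm]
  unfold quadForm
  rw [t1, t2, t3]
  simp only [Matrix.trace, Matrix.diag_apply, Matrix.mul_apply (M := _ * _) (N := Zᴴ),
    Matrix.mul_diagonal, Matrix.diagonal_mul, Matrix.conjTranspose_apply, Complex.re_sum,
    Finset.mul_sum, ← Finset.sum_sub_distrib]
  refine Finset.sum_congr rfl fun i _ => Finset.sum_congr rfl fun j _ => ?_
  rw [Complex.sq_norm, Complex.normSq_apply]
  simp
  ring

end RelativeEntropy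

section RelativeEntropy

namespace Matrix.IsHermitian

/-- The eigenvector matrix of a Hermitian matrix. -/
noncomputable def eigMat {ρ : Matrix A A ℂ} (h : ρ.IsHermitian) : Matrix A A ℂ :=
  h.eigenvectorUnitary

lemma eigMat_conjTranspose_mul {ρ : Matrix A A ℂ} (h : ρ.IsHermitian) :
    h.eigMatᴴ * h.eigMat = 1 :=
  Unitary.coe_star_mul_self h.eigenvectorUnitary

lemma eigMat_mul_conjTranspose {ρ : Matrix A A ℂ} (h : ρ.IsHermitian) :
    h.eigMat * h.eigMatᴴ = 1 :=
  Unitary.coe_mul_star_self h.eigenvectorUnitary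

lemma eq_eigMat_mul {ρ : Matrix A A ℂ} (h : ρ.IsHermitian) :
    ρ = h.eigMat * Matrix.diagonal (fun j => (h.eigenvalues j : ℂ)) * h.eigMatᴴ := by
  conv_lhs => rw [h.spectral_theorem, Unitary.conjStarAlgAut_apply]
  rfl

lemma eigMat_conj {ρ : Matrix A A ℂ} (h : ρ.IsHermitian) :
    h.eigMatᴴ * ρ * h.eigMat = Matrix.diagonal (fun j => (h.eigenvalues j : ℂ)) := by
  have e : h.eigMatᴴ * ρ * h.eigMat = h.eigMatᴴ * (h.eigMat *
      Matrix.diagonal (fun j => (h.eigenvalues j : ℂ)) * h.eigMatᴴ) * h.eigMat := by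
    rw [← h.eq_eigMat_mul]
  rw [e]
  simp only [Matrix.mul_assoc, h.eigMat_conjTranspose_mul, Matrix.mul_one]
  rw [← Matrix.mul_assoc, h.eigMat_conjTranspose_mul, Matrix.one_mul]

/-- Squared overlaps between the eigenvectors of two Hermitian matrices. -/
noncomputable def overlap {ρ σ : Matrix A A ℂ} (hρ : ρ.IsHermitian) (hσ : σ.IsHermitian)
    (i j : A) : ℝ :=
  ‖(hσ.eigMatᴴ * hρ.eigMat) i j‖ ^ 2

variable {ρ σ : Matrix A A ℂ}

lemma overlap_nonneg (hρ : ρ.IsHermitian) (hσ : σ.IsHermitian) (i j : A) :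
    0 ≤ hρ.overlap hσ i j := by
  unfold overlap; positivity

lemma sum_overlap (hρ : ρ.IsHermitian) (hσ : σ.IsHermitian) (j : A) :
    ∑ i, hρ.overlap hσ i j = 1 := by
  have h : (hσ.eigMatᴴ * hρ.eigMat)ᴴ * (hσ.eigMatᴴ * hρ.eigMat) = 1 := by
    rw [Matrix.conjTranspose_mul, Matrix.conjTranspose_conjTranspose, Matrix.mul_assoc,
      ← Matrix.mul_assoc hσ.eigMat, hσ.eigMat_mul_conjTranspose, Matrix.one_mul,
      hρ.eigMat_conjTranspose_mul]
  have h2 := congrFun (congrFun h j) j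
  rw [Matrix.mul_apply, Matrix.one_apply_eq] at h2
  have h3 := congrArg Complex.re h2
  rw [Complex.re_sum, Complex.one_re] at h3
  rw [← h3]
  refine Finset.sum_congr rfl fun i _ => ?_
  rw [overlap, Complex.sq_norm, Complex.normSq_apply, Matrix.conjTranspose_apply]
  simp

lemma sum_overlap_mul_eigenvalues (hρ : ρ.IsHermitian) (hσ : σ.IsHermitian) (i : A) :
    ∑ j, hρ.overlap hσ i j * hρ.eigenvalues j = ((hσ.eigMatᴴ * ρ * hσ.eigMat) i i).re := by
  set W := hσ.eigMatᴴ * hρ.eigMat with hW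
  have : hσ.eigMatᴴ * ρ * hσ.eigMat =
      W * Matrix.diagonal (fun j => (hρ.eigenvalues j : ℂ)) * Wᴴ := by
    conv_lhs => rw [hρ.eq_eigMat_mul]
    simp only [hW, Matrix.conjTranspose_mul, Matrix.conjTranspose_conjTranspose,
      Matrix.mul_assoc]
  rw [this, Matrix.mul_apply, Complex.re_sum]
  refine Finset.sum_congr rfl fun j _ => ?_
  rw [overlap, Complex.sq_norm, Complex.normSq_apply, Matrix.conjTranspose_apply,
    Matrix.mul_diagonal]
  simp
  ring

lemma sum_sum_overlap_mul_eigenvalues (hρ : ρ.IsHermitian) (hσ : σ.IsHermitian) :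
    ∑ i, ∑ j, hρ.overlap hσ i j * hρ.eigenvalues j = ρ.trace.re := by
  rw [Finset.sum_comm, hρ.trace_eq_sum_eigenvalues, Complex.re_sum]
  refine Finset.sum_congr rfl fun j _ => ?_
  rw [← Finset.sum_mul, hρ.sum_overlap hσ, one_mul]
  simp

lemma overlap_mul_eigenvalues_eq_zero (hρ : ρ.PosSemidef) (hσ : σ.IsHermitian)
    (h : (σ - ρ).PosSemidef) {i : A} (hi : hσ.eigenvalues i = 0) (j : A) :
    hρ.1.overlap hσ i j * hρ.1.eigenvalues j = 0 := by
  have h1 := (h.conjTranspose_mul_mul_same hσ.eigMat).diag_nonneg (i := i)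
  rw [Matrix.mul_sub, Matrix.sub_mul, hσ.eigMat_conj] at h1
  have h2 := (Complex.le_def.1 h1).1
  rw [Matrix.sub_apply, Matrix.diagonal_apply_eq, hi] at h2
  simp only [Complex.sub_re, Complex.ofReal_zero, Complex.zero_re] at h2
  rw [← hρ.1.sum_overlap_mul_eigenvalues] at h2
  have hnn : ∀ j ∈ Finset.univ, 0 ≤ hρ.1.overlap hσ i j * hρ.1.eigenvalues j := fun j _ =>
    mul_nonneg (hρ.1.overlap_nonneg hσ i j) (hρ.eigenvalues_nonneg j)
  have h3 : ∑ j, hρ.1.overlap hσ i j * hρ.1.eigenvalues j = 0 :=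
    le_antisymm (by linarith) (Finset.sum_nonneg hnn)
  exact (Finset.sum_eq_zero_iff_of_nonneg hnn).1 h3 j (Finset.mem_univ j)

/-- `⟨ρ, (L_σ + s R_ρ)⁻¹ ρ⟩` in terms of eigenvalues and eigenvector overlaps. -/
noncomputable def resolventForm (s : ℝ) (hρ : ρ.IsHermitian) (hσ : σ.IsHermitian) : ℝ :=
  ∑ i, ∑ j, hρ.overlap hσ i j *
    (hρ.eigenvalues j ^ 2 / (hσ.eigenvalues i + s * hρ.eigenvalues j))

lemma quadForm_le_resolventForm (hρ : ρ.PosSemidef) (hσ : σ.PosSemidef) {s : ℝ} (hs : 0 < s)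
    (X : Matrix A A ℂ) : quadForm s ρ σ X ≤ resolventForm s hρ.1 hσ.1 := by
  have hX : X = hσ.1.eigMat * (hσ.1.eigMatᴴ * X * hρ.1.eigMat) * hρ.1.eigMatᴴ := by
    simp only [Matrix.mul_assoc, hρ.1.eigMat_mul_conjTranspose, Matrix.mul_one]
    rw [← Matrix.mul_assoc, hσ.1.eigMat_mul_conjTranspose, Matrix.one_mul]
  set Z := hσ.1.eigMatᴴ * X * hρ.1.eigMat with hZ
  have h := quadForm_diagonal s hσ.1.eigMat_conjTranspose_mul hρ.1.eigMat_conjTranspose_mul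
    hσ.1.eigenvalues hρ.1.eigenvalues Z
  rw [← hρ.1.eq_eigMat_mul, ← hσ.1.eq_eigMat_mul, ← hX] at h
  rw [h]
  refine Finset.sum_le_sum fun i _ => Finset.sum_le_sum fun j _ => ?_
  unfold overlap
  set w := (hσ.1.eigMatᴴ * hρ.1.eigMat) i j
  set z := Z i j
  have hr := hρ.eigenvalues_nonneg j
  have hm := hσ.eigenvalues_nonneg i
  set r := hρ.1.eigenvalues j
  set m := hσ.1.eigenvalues i
  have hzw : (star z * w).re ≤ ‖z‖ * ‖w‖ := by
    refine (Complex.re_le_norm _).trans ?_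
    rw [norm_mul, norm_star]
  rcases hr.eq_or_lt with h0 | h0
  · rw [← h0]
    have : 0 ≤ ‖z‖ ^ 2 * m := by positivity
    simp only [mul_zero, add_zero, ne_eq, OfNat.ofNat_ne_zero, not_false_eq_true, zero_pow,
      zero_div]
    linarith
  · have hd : 0 < m + s * r := by positivity
    have h1 := mul_le_mul_of_nonneg_right hzw hr
    rw [← mul_div_assoc, le_div_iff₀ hd]
    nlinarith [sq_nonneg (‖z‖ * (m + s * r) - ‖w‖ * r), mul_le_mul_of_nonneg_right h1 hd.le]

lemma exists_quadForm_eq_resolventForm (hρ : ρ.PosSemidef) (hσ : σ.PosSemidef) {s : ℝ}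
    (hs : 0 < s) : ∃ X : Matrix A A ℂ, quadForm s ρ σ X = resolventForm s hρ.1 hσ.1 := by
  let Z : Matrix A A ℂ := Matrix.of fun i j => (hσ.1.eigMatᴴ * hρ.1.eigMat) i j *
    ((hρ.1.eigenvalues j / (hσ.1.eigenvalues i + s * hρ.1.eigenvalues j) : ℝ) : ℂ)
  refine ⟨hσ.1.eigMat * Z * hρ.1.eigMatᴴ, ?_⟩
  have h := quadForm_diagonal s hσ.1.eigMat_conjTranspose_mul hρ.1.eigMat_conjTranspose_mul
    hσ.1.eigenvalues hρ.1.eigenvalues Z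
  rw [← hρ.1.eq_eigMat_mul, ← hσ.1.eq_eigMat_mul] at h
  rw [h]
  refine Finset.sum_congr rfl fun i _ => Finset.sum_congr rfl fun j _ => ?_
  simp only [overlap, Z, Matrix.of_apply]
  set w := (hσ.1.eigMatᴴ * hρ.1.eigMat) i j
  have hr := hρ.eigenvalues_nonneg j
  have hm := hσ.eigenvalues_nonneg i
  set r := hρ.1.eigenvalues j
  set m := hσ.1.eigenvalues i
  have e1 : (star (w * ((r / (m + s * r) : ℝ) : ℂ)) * w).re = ‖w‖ ^ 2 * (r / (m + s * r)) := by
    rw [Complex.sq_norm, Complex.normSq_apply, star_mul']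
    simp only [Complex.star_def, Complex.conj_ofReal, Complex.mul_re, Complex.mul_im,
      Complex.conj_re, Complex.conj_im, Complex.ofReal_re, Complex.ofReal_im]
    ring
  rw [e1, norm_mul, Complex.norm_real, mul_pow, Real.norm_eq_abs, sq_abs]
  rcases hr.eq_or_lt with h0 | h0
  · simp [← h0]
  · have hd : m + s * r ≠ 0 := by positivity
    field_simp
    ring

lemma resolventForm_apply_le (M : KrausFamily A B) (hM : M.IsChannel)
    (hρ : ρ.PosSemidef) (hσ : σ.PosSemidef)
    (hMρ : (M.apply ρ).PosSemidef) (hMσ : (M.apply σ).PosSemidef) {s : ℝ} (hs : 0 < s) :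
    resolventForm s hMρ.1 hMσ.1 ≤ resolventForm s hρ.1 hσ.1 := by
  obtain ⟨X, hX⟩ := exists_quadForm_eq_resolventForm hMρ hMσ hs
  rw [← hX]
  exact (quadForm_apply_le M hM hρ hσ hs.le X).trans (quadForm_le_resolventForm hρ hσ hs _)

/-- The quantum relative entropy (natural logarithm) in terms of eigenvalues. -/
noncomputable def relEnt (hρ : ρ.IsHermitian) (hσ : σ.IsHermitian) : ℝ :=
  ∑ i, ∑ j, hρ.overlap hσ i j * hρ.eigenvalues j *
    (Real.log (hρ.eigenvalues j) - Real.log (hσ.eigenvalues i))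

/-- `∫₀ᴸ resolventForm s ds` in closed form. -/
noncomputable def resolventInt (L : ℝ) (hρ : ρ.IsHermitian) (hσ : σ.IsHermitian) : ℝ :=
  ∑ i, ∑ j, hρ.overlap hσ i j * hρ.eigenvalues j *
    (Real.log (hσ.eigenvalues i + L * hρ.eigenvalues j) - Real.log (hσ.eigenvalues i))

lemma resolventInt_zero (hρ : ρ.IsHermitian) (hσ : σ.IsHermitian) :
    resolventInt 0 hρ hσ = 0 := by
  simp [resolventInt]

lemma hasDerivAt_resolventInt (hρ : ρ.PosSemidef) (hσ : σ.PosSemidef)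
    (h : (σ - ρ).PosSemidef) {L : ℝ} (hL : 0 ≤ L) :
    HasDerivAt (fun L => resolventInt L hρ.1 hσ.1) (resolventForm L hρ.1 hσ.1) L := by
  unfold resolventInt resolventForm
  refine HasDerivAt.fun_sum fun i _ => HasDerivAt.fun_sum fun j _ => ?_
  have hz := overlap_mul_eigenvalues_eq_zero hρ hσ.1 h (i := i) (j := j)
  have hr := hρ.eigenvalues_nonneg j
  have hm := hσ.eigenvalues_nonneg i
  set r := hρ.1.eigenvalues j
  set m := hσ.1.eigenvalues i
  set c := hρ.1.overlap hσ.1 i j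
  rcases hm.eq_or_lt with h0 | h0
  · have hz' := hz h0.symm
    have : c * (r ^ 2 / (m + L * r)) = 0 := by
      rw [show c * (r ^ 2 / (m + L * r)) = c * r * (r / (m + L * r)) by ring, hz', zero_mul]
    rw [this]
    simp only [hz', zero_mul]
    exact hasDerivAt_const _ _
  · have hd : m + L * r ≠ 0 := by positivity
    have h1 : HasDerivAt (fun L : ℝ => m + L * r) r L := by
      simpa using ((hasDerivAt_id L).mul_const r).const_add m
    have h2 := ((h1.log hd).sub_const (Real.log m)).const_mul (c * r)
    rw [show c * (r ^ 2 / (m + L * r)) = c * r * (r / (m + L * r)) by ring]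
    exact h2

lemma tendsto_resolventInt (hρ : ρ.PosSemidef) (hσ : σ.PosSemidef) :
    Filter.Tendsto (fun L => resolventInt L hρ.1 hσ.1 - Real.log L * ρ.trace.re) Filter.atTop
      (nhds (relEnt hρ.1 hσ.1)) := by
  have e : ∀ L, resolventInt L hρ.1 hσ.1 - Real.log L * ρ.trace.re =
      ∑ i, ∑ j, hρ.1.overlap hσ.1 i j * hρ.1.eigenvalues j *
        (Real.log (hσ.1.eigenvalues i + L * hρ.1.eigenvalues j) - Real.log L
          - Real.log (hσ.1.eigenvalues i)) := by
    intro L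
    rw [← hρ.1.sum_sum_overlap_mul_eigenvalues hσ.1, resolventInt, Finset.mul_sum,
      ← Finset.sum_sub_distrib]
    refine Finset.sum_congr rfl fun i _ => ?_
    rw [Finset.mul_sum, ← Finset.sum_sub_distrib]
    exact Finset.sum_congr rfl fun j _ => by ring
  simp only [e, relEnt]
  refine tendsto_finsetSum _ fun i _ => tendsto_finsetSum _ fun j _ => ?_
  have hr := hρ.eigenvalues_nonneg j
  have hm := hσ.eigenvalues_nonneg i
  set r := hρ.1.eigenvalues j
  set m := hσ.1.eigenvalues i
  rcases hr.eq_or_lt with h0 | h0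
  · simp [← h0]
  · refine Filter.Tendsto.const_mul _ (Filter.Tendsto.sub_const ?_ _)
    have h1 : Filter.Tendsto (fun L : ℝ => m / L + r) Filter.atTop (nhds (0 + r)) :=
      (tendsto_const_nhds.div_atTop Filter.tendsto_id).add_const r
    rw [zero_add] at h1
    refine (h1.log h0.ne').congr' ?_
    filter_upwards [Filter.eventually_gt_atTop 0] with L hL
    have : m / L + r ≠ 0 := by positivity
    rw [show m + L * r = (m / L + r) * L by field_simp, Real.log_mul this hL.ne']
    ring

end Matrix.IsHermitian

lemma KrausFamily.apply_posSemidef (M : KrausFamily A B) {ρ : Matrix A A ℂ}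
    (hρ : ρ.PosSemidef) : (M.apply ρ).PosSemidef :=
  Matrix.posSemidef_sum _ fun _ _ => hρ.mul_mul_conjTranspose_same _

lemma KrausFamily.apply_sub (M : KrausFamily A B) (ρ σ : Matrix A A ℂ) :
    M.apply (σ - ρ) = M.apply σ - M.apply ρ := by
  simp [KrausFamily.apply, Matrix.mul_sub, Matrix.sub_mul]

lemma KrausFamily.apply_sum (M : KrausFamily A B) {τ : Type*} (s : Finset τ)
    (ρ : τ → Matrix A A ℂ) : M.apply (∑ t ∈ s, ρ t) = ∑ t ∈ s, M.apply (ρ t) := by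
  simp only [KrausFamily.apply, Matrix.mul_sum, Matrix.sum_mul]
  exact Finset.sum_comm

lemma KrausFamily.trace_apply (M : KrausFamily A B) (hM : M.IsChannel) (ρ : Matrix A A ℂ) :
    (M.apply ρ).trace = ρ.trace := by
  have h : M.dual 1 = 1 := by
    simpa [KrausFamily.dual] using (show ∑ i, (M.K i)ᴴ * M.K i = 1 from hM)
  have := M.trace_dual_mul 1 ρ
  rw [h, one_mul, one_mul] at this
  exact this.symm

/-- Monotonicity of the quantum relative entropy under channels. -/
theorem relEnt_apply_le (M : KrausFamily A B) (hM : M.IsChannel) {ρ σ : Matrix A A ℂ}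
    (hρ : ρ.PosSemidef) (hσ : σ.PosSemidef) (h : (σ - ρ).PosSemidef) :
    (M.apply_posSemidef hρ).1.relEnt (M.apply_posSemidef hσ).1 ≤ hρ.1.relEnt hσ.1 := by
  have hMρ := M.apply_posSemidef hρ
  have hMσ := M.apply_posSemidef hσ
  have hMh : (M.apply σ - M.apply ρ).PosSemidef := by
    rw [← M.apply_sub]; exact M.apply_posSemidef h
  have hle : ∀ L : ℝ, 0 ≤ L → Matrix.IsHermitian.resolventInt L hMρ.1 hMσ.1 ≤
      Matrix.IsHermitian.resolventInt L hρ.1 hσ.1 := by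
    have hd : ∀ L : ℝ, 0 ≤ L → HasDerivAt
        (fun L => Matrix.IsHermitian.resolventInt L hρ.1 hσ.1 -
          Matrix.IsHermitian.resolventInt L hMρ.1 hMσ.1) _ L := fun L hL =>
      (Matrix.IsHermitian.hasDerivAt_resolventInt hρ hσ h hL).sub
        (Matrix.IsHermitian.hasDerivAt_resolventInt hMρ hMσ hMh hL)
    have hmono := monotoneOn_of_deriv_nonneg (convex_Ici (0 : ℝ))
      (fun L hL => (hd L hL).continuousAt.continuousWithinAt)
      (fun L hL => (hd L (interior_subset hL)).differentiableAt.differentiableWithinAt)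
      (fun L hL => by
        rw [(hd L (interior_subset hL)).deriv]
        rw [interior_Ici] at hL
        exact sub_nonneg.2
          (Matrix.IsHermitian.resolventForm_apply_le M hM hρ hσ hMρ hMσ hL))
    intro L hL
    have := hmono (Set.self_mem_Ici) hL hL
    simp only [Matrix.IsHermitian.resolventInt_zero] at this
    linarith
  refine le_of_tendsto_of_tendsto (Matrix.IsHermitian.tendsto_resolventInt hMρ hMσ)
    (Matrix.IsHermitian.tendsto_resolventInt hρ hσ) ?_
  filter_upwards [Filter.eventually_ge_atTop 0] with L hL
  rw [M.trace_apply hM]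
  exact sub_le_sub_right (hle L hL) _

end RelativeEntropy

section Entropy

lemma vnEntropy_eq {ρ : Matrix A A ℂ} (h : ρ.IsHermitian) :
    vnEntropy ρ = -∑ j, h.eigenvalues j * Real.logb 2 (h.eigenvalues j) :=
  dif_pos h

lemma Matrix.IsHermitian.relEnt_eq {ρ σ : Matrix A A ℂ} (hρ : ρ.IsHermitian)
    (hσ : σ.IsHermitian) :
    hρ.relEnt hσ = -(Real.log 2 * vnEntropy ρ) -
      ∑ i, ((hσ.eigMatᴴ * ρ * hσ.eigMat) i i).re * Real.log (hσ.eigenvalues i) := by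
  have h2 : Real.log 2 ≠ 0 := (Real.log_pos one_lt_two).ne'
  have e1 : -(Real.log 2 * vnEntropy ρ) =
      ∑ i, ∑ j, hρ.overlap hσ i j * (hρ.eigenvalues j * Real.log (hρ.eigenvalues j)) := by
    rw [Finset.sum_comm, vnEntropy_eq hρ, mul_neg, neg_neg, Finset.mul_sum]
    refine Finset.sum_congr rfl fun j _ => ?_
    rw [← Finset.sum_mul, hρ.sum_overlap hσ, Real.logb]
    field_simp
  rw [e1, Matrix.IsHermitian.relEnt, ← Finset.sum_sub_distrib]
  refine Finset.sum_congr rfl fun i _ => ?_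
  rw [← hρ.sum_overlap_mul_eigenvalues hσ, Finset.sum_mul, ← Finset.sum_sub_distrib]
  exact Finset.sum_congr rfl fun j _ => by ring

lemma sum_relEnt {τ : Type*} [Fintype τ] {ρ : τ → Matrix A A ℂ}
    (hρ : ∀ t, (ρ t).IsHermitian) {σ : Matrix A A ℂ} (hσ : σ.IsHermitian)
    (h : ∑ t, ρ t = σ) :
    ∑ t, (hρ t).relEnt hσ = Real.log 2 * (vnEntropy σ - ∑ t, vnEntropy (ρ t)) := by
  have h2 : Real.log 2 ≠ 0 := (Real.log_pos one_lt_two).ne'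
  have e : ∀ i, ∑ t, ((hσ.eigMatᴴ * ρ t * hσ.eigMat) i i).re = hσ.eigenvalues i := by
    intro i
    have h3 : hσ.eigMatᴴ * (∑ t, ρ t) * hσ.eigMat =
        Matrix.diagonal (fun j => (hσ.eigenvalues j : ℂ)) := by
      rw [h, hσ.eigMat_conj]
    have h4 := congrArg Complex.re (congrFun (congrFun h3 i) i)
    rw [Matrix.mul_sum, Matrix.sum_mul, Matrix.sum_apply, Complex.re_sum,
      Matrix.diagonal_apply_eq, Complex.ofReal_re] at h4
    exact h4
  simp only [Matrix.IsHermitian.relEnt_eq, Finset.sum_sub_distrib]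
  rw [Finset.sum_comm]
  simp only [← Finset.sum_mul, e]
  have e5 : ∑ i, hσ.eigenvalues i * Real.log (hσ.eigenvalues i) =
      -(Real.log 2 * vnEntropy σ) := by
    rw [vnEntropy_eq hσ, mul_neg, neg_neg, Finset.mul_sum]
    refine Finset.sum_congr rfl fun j _ => ?_
    rw [Real.logb]
    field_simp
  rw [e5, Finset.sum_neg_distrib, ← Finset.mul_sum]
  ring

/-- The Holevo quantity of an ensemble of subnormalised states does not increase
under a channel. -/
theorem holevo_apply_le (M : KrausFamily A B) (hM : M.IsChannel) {τ : Type*} [Fintype τ]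
    {ρ : τ → Matrix A A ℂ} (hρ : ∀ t, (ρ t).PosSemidef) :
    vnEntropy (M.apply (∑ t, ρ t)) - ∑ t, vnEntropy (M.apply (ρ t)) ≤
      vnEntropy (∑ t, ρ t) - ∑ t, vnEntropy (ρ t) := by
  classical
  have hσ : (∑ t, ρ t).PosSemidef := Matrix.posSemidef_sum _ fun t _ => hρ t
  have hle : ∀ t, (∑ t, ρ t - ρ t).PosSemidef := by
    intro t
    rw [← Finset.add_sum_erase _ _ (Finset.mem_univ t), add_sub_cancel_left]
    exact Matrix.posSemidef_sum _ fun t _ => hρ t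
  have h1 : ∑ t, (M.apply_posSemidef (hρ t)).1.relEnt (M.apply_posSemidef hσ).1 ≤
      ∑ t, (hρ t).1.relEnt hσ.1 :=
    Finset.sum_le_sum fun t _ => relEnt_apply_le M hM (hρ t) hσ (hle t)
  rw [sum_relEnt (fun t => (hρ t).1) hσ.1 rfl,
    sum_relEnt (fun t => (M.apply_posSemidef (hρ t)).1) _ (M.apply_sum _ _).symm] at h1
  exact le_of_mul_le_mul_left h1 (Real.log_pos one_lt_two)

lemma vnEntropy_eq_sum_roots {ρ : Matrix A A ℂ} (h : ρ.IsHermitian) :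
    vnEntropy ρ = (ρ.charpoly.roots.map fun z => -(z.re * Real.logb 2 z.re)).sum := by
  rw [h.roots_charpoly_eq_eigenvalues, vnEntropy_eq h, Multiset.map_map,
    ← Finset.sum_neg_distrib]
  rfl

open Polynomial in
lemma vnEntropy_congr {ρ : Matrix A A ℂ} {σ : Matrix B B ℂ} (hρ : ρ.IsHermitian)
    (hσ : σ.IsHermitian) {a b : ℕ}
    (h : (X : ℂ[X]) ^ a * ρ.charpoly = X ^ b * σ.charpoly) : vnEntropy ρ = vnEntropy σ := by
  have h1 := congrArg Polynomial.roots h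
  rw [Polynomial.roots_mul (mul_ne_zero (by simp) ρ.charpoly_monic.ne_zero),
    Polynomial.roots_mul (mul_ne_zero (by simp) σ.charpoly_monic.ne_zero)] at h1
  have h2 := congrArg (fun s : Multiset ℂ =>
    (s.map fun z => -(z.re * Real.logb 2 z.re)).sum) h1
  simpa [Multiset.map_nsmul, Multiset.sum_nsmul, ← vnEntropy_eq_sum_roots hρ, ← vnEntropy_eq_sum_roots hσ] using h2

lemma vnEntropy_mul_conjTranspose (V : Matrix A B ℂ) :
    vnEntropy (V * Vᴴ) = vnEntropy (Vᴴ * V) :=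
  vnEntropy_congr (Matrix.isHermitian_mul_conjTranspose_self V)
    (Matrix.isHermitian_conjTranspose_mul_self V) (Matrix.charpoly_mul_comm' V Vᴴ)

lemma vnEntropy_transpose {ρ : Matrix A A ℂ} (h : ρ.IsHermitian) :
    vnEntropy ρᵀ = vnEntropy ρ := by
  rw [vnEntropy_eq_sum_roots h, vnEntropy_eq_sum_roots h.transpose, Matrix.charpoly_transpose]

open Polynomial in
lemma Matrix.charpoly_blockDiagonal (ρ : B → Matrix A A ℂ) :
    (Matrix.blockDiagonal ρ).charpoly = ∏ t, (ρ t).charpoly := by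
  have : (Matrix.blockDiagonal ρ).charmatrix =
      Matrix.blockDiagonal fun t => (ρ t).charmatrix := by
    ext ⟨a, t⟩ ⟨a', t'⟩
    simp only [Matrix.charmatrix_apply, Matrix.blockDiagonal_apply, Matrix.diagonal_apply,
      Prod.mk.injEq]
    by_cases h : t = t'
    · simp [h]
    · simp [h]
  rw [Matrix.charpoly, this, Matrix.det_blockDiagonal]
  rfl

lemma vnEntropy_block {τ : Type} [Fintype τ] [DecidableEq τ] {ρ : τ → Matrix A A ℂ}
    (hρ : ∀ t, (ρ t).IsHermitian) {ω : Matrix (τ × A) (τ × A) ℂ}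
    (hω : ∀ t a t' a', ω (t, a) (t', a') = if t = t' then ρ t a a' else 0) :
    vnEntropy ω = ∑ t, vnEntropy (ρ t) := by
  have e : ω = Matrix.reindex (Equiv.prodComm _ _) (Equiv.prodComm _ _)
      (Matrix.blockDiagonal ρ) := by
    ext ⟨t, a⟩ ⟨t', a'⟩
    simp [hω, Matrix.blockDiagonal_apply]
  have hh : ω.IsHermitian := by
    ext ⟨t, a⟩ ⟨t', a'⟩
    rw [Matrix.conjTranspose_apply, hω, hω]
    by_cases h : t = t'
    · subst h
      simpa using (hρ t).apply a a'
    · simp [h, Ne.symm h]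
  rw [vnEntropy_eq_sum_roots hh]
  have hc : ω.charpoly = ∏ t, (ρ t).charpoly := by
    rw [e, Matrix.charpoly_reindex, Matrix.charpoly_blockDiagonal]
  rw [hc, Polynomial.roots_prod _ _
    (Finset.prod_ne_zero_iff.2 fun t _ => (ρ t).charpoly_monic.ne_zero)]
  simp only [vnEntropy_eq_sum_roots (hρ _), Multiset.map_bind, Multiset.sum_bind]
  rfl

lemma IsDensity.sum_eigenvalues {ρ : Matrix A A ℂ} (h : IsDensity ρ) :
    ∑ j, h.1.1.eigenvalues j = 1 := by
  simpa using congrArg Complex.re (h.1.1.trace_eq_sum_eigenvalues.symm.trans h.2)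

lemma IsDensity.vnEntropy_nonneg {ρ : Matrix A A ℂ} (h : IsDensity ρ) : 0 ≤ vnEntropy ρ := by
  rw [vnEntropy_eq h.1.1, ← Finset.sum_neg_distrib]
  refine Finset.sum_nonneg fun j _ => ?_
  have h0 := h.1.eigenvalues_nonneg j
  have h1 : h.1.1.eigenvalues j ≤ 1 := by
    rw [← h.sum_eigenvalues]
    exact Finset.single_le_sum (fun i _ => h.1.eigenvalues_nonneg i) (Finset.mem_univ j)
  have := mul_nonneg h0 (neg_nonneg.2 (Real.logb_nonpos one_lt_two h0 h1))
  linarith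

lemma IsDensity.vnEntropy_le {ρ : Matrix A A ℂ} (h : IsDensity ρ) :
    vnEntropy ρ ≤ Real.logb 2 (Fintype.card A) := by
  have hl : 0 < Real.log 2 := Real.log_pos one_lt_two
  have hne : Nonempty A := by
    by_contra hA
    rw [not_nonempty_iff] at hA
    simpa using h.sum_eigenvalues
  have hc : (0 : ℝ) < Fintype.card A := by exact_mod_cast Fintype.card_pos
  set c : ℝ := (Fintype.card A : ℝ)
  have key : ∀ j, -(h.1.1.eigenvalues j * Real.log (h.1.1.eigenvalues j)) ≤
      h.1.1.eigenvalues j * Real.log c + (c⁻¹ - h.1.1.eigenvalues j) := by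
    intro j
    rcases (h.1.eigenvalues_nonneg j).eq_or_lt with h0 | h0
    · rw [← h0]; simpa using hc.le
    · set x := h.1.1.eigenvalues j
      have h1 := Real.log_le_sub_one_of_pos (show 0 < (c * x)⁻¹ by positivity)
      rw [Real.log_inv, Real.log_mul hc.ne' h0.ne'] at h1
      have h2 := mul_le_mul_of_nonneg_left h1 h0.le
      have h3 : x * ((c * x)⁻¹ - 1) = c⁻¹ - x := by field_simp
      rw [h3] at h2
      linarith
  have h2 := Finset.sum_le_sum fun j (_ : j ∈ Finset.univ) => key j
  rw [Finset.sum_add_distrib, Finset.sum_sub_distrib, ← Finset.sum_mul, h.sum_eigenvalues,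
    Finset.sum_const, Finset.card_univ, nsmul_eq_mul,
    show c * c⁻¹ = 1 from mul_inv_cancel₀ hc.ne', Finset.sum_neg_distrib]
    at h2
  rw [vnEntropy_eq h.1.1, Real.logb, le_div_iff₀ hl, neg_mul, Finset.sum_mul]
  have h3 : ∀ j, h.1.1.eigenvalues j * Real.logb 2 (h.1.1.eigenvalues j) * Real.log 2 =
      h.1.1.eigenvalues j * Real.log (h.1.1.eigenvalues j) := by
    intro j; rw [Real.logb]; field_simp
  simp only [h3]
  linarith

end Entropy

section Channels

namespace KrausFamily

variable {C : Type} [Fintype C] [DecidableEq C]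

/-- The Kraus family of the composition `R ∘ T`. -/
noncomputable def comp (R : KrausFamily B C) (T : KrausFamily A B) : KrausFamily A C where
  ι := R.ι × T.ι
  K p := R.K p.1 * T.K p.2

lemma comp_apply (R : KrausFamily B C) (T : KrausFamily A B) (ρ : Matrix A A ℂ) :
    (R.comp T).apply ρ = R.apply (T.apply ρ) := by
  change ∑ p : R.ι × T.ι, R.K p.1 * T.K p.2 * ρ * (R.K p.1 * T.K p.2)ᴴ = _
  rw [Fintype.sum_prod_type]
  simp only [apply, Matrix.mul_sum, Matrix.sum_mul, Matrix.conjTranspose_mul, Matrix.mul_assoc]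

/-- The partial trace over the first factor, as a Kraus family. -/
noncomputable def traceLeft (J I : Type) [Fintype J] [DecidableEq J] [Fintype I]
    [DecidableEq I] : KrausFamily (J × I) I where
  ι := J
  K j := Matrix.of fun i p => if p = (j, i) then 1 else 0

section traceLeft

variable (J I : Type) [Fintype J] [DecidableEq J] [Fintype I] [DecidableEq I]

lemma traceLeft_isChannel : (traceLeft J I).IsChannel := by
  change ∑ j : J, (Matrix.of fun (i : I) (p : J × I) => if p = (j, i) then (1 : ℂ) else 0)ᴴ *
    (Matrix.of fun (i : I) (p : J × I) => if p = (j, i) then (1 : ℂ) else 0) = 1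
  ext ⟨j, i⟩ ⟨j', i'⟩
  simp [Matrix.sum_apply, Matrix.mul_apply, Matrix.one_apply, ite_and, apply_ite]
  split_ifs <;> simp_all

lemma traceLeft_apply (ω : Matrix (J × I) (J × I) ℂ) (i i' : I) :
    (traceLeft J I).apply ω i i' = ∑ j, ω (j, i) (j, i') := by
  change (∑ j : J, (Matrix.of fun (i : I) (p : J × I) => if p = (j, i) then (1 : ℂ) else 0) * ω *
    (Matrix.of fun (i : I) (p : J × I) => if p = (j, i) then (1 : ℂ) else 0)ᴴ) i i' = _
  simp [Matrix.sum_apply, Matrix.mul_apply, apply_ite]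

end traceLeft

lemma traceLeft_comp_compl (R : KrausFamily B C) (hR : R.IsChannel) (T : KrausFamily A B)
    (ρ : Matrix A A ℂ) :
    (traceLeft R.ι T.ι).apply ((R.comp T).compl ρ) = T.compl ρ := by
  ext i i'
  refine (traceLeft_apply _ _ _ _ _).trans ?_
  change ∑ j, (R.K j * T.K i * ρ * (R.K j * T.K i')ᴴ).trace = (T.K i * ρ * (T.K i')ᴴ).trace
  have h : ∀ j, (R.K j * T.K i * ρ * (R.K j * T.K i')ᴴ).trace =
      ((R.K j)ᴴ * R.K j * (T.K i * ρ * (T.K i')ᴴ)).trace := by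
    intro j
    rw [Matrix.mul_assoc _ᴴ, Matrix.trace_mul_comm _ᴴ]
    simp only [Matrix.conjTranspose_mul, Matrix.mul_assoc]
  have hR' : ∑ j, (R.K j)ᴴ * R.K j = 1 := hR
  simp only [h]
  rw [← Matrix.trace_sum, ← Matrix.sum_mul, hR', Matrix.one_mul]

lemma compl_sum (T : KrausFamily A B) {τ : Type*} (s : Finset τ) (ρ : τ → Matrix A A ℂ) :
    T.compl (∑ t ∈ s, ρ t) = ∑ t ∈ s, T.compl (ρ t) := by
  ext i j
  simp [compl, Matrix.mul_sum, Matrix.sum_mul, Matrix.trace_sum, Matrix.sum_apply]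

lemma trace_compl (T : KrausFamily A B) (ρ : Matrix A A ℂ) :
    (T.compl ρ).trace = (T.apply ρ).trace := by
  simp only [apply, Matrix.trace_sum]
  rfl

/-- The matrix whose `i`-th column is the vectorisation of `Kᵢ s`. -/
noncomputable def stack {D : Type} (N : KrausFamily A B) (s : Matrix A D ℂ) :
    Matrix (B × D) N.ι ℂ :=
  Matrix.of fun p i => (N.K i * s) p.1 p.2

lemma compl_mul_conjTranspose {D : Type} [Fintype D] (N : KrausFamily A B)
    (s : Matrix A D ℂ) : N.compl (s * sᴴ) = ((N.stack s)ᴴ * N.stack s)ᵀ := by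
  ext i j
  have h : N.K i * (s * sᴴ) * (N.K j)ᴴ = (N.K i * s) * (N.K j * s)ᴴ := by
    simp only [Matrix.conjTranspose_mul, Matrix.mul_assoc]
  rw [compl, Matrix.of_apply, h, Matrix.transpose_apply, Matrix.mul_apply,
    Fintype.sum_prod_type]
  simp only [Matrix.trace, Matrix.diag_apply, Matrix.mul_apply (N := (N.K j * s)ᴴ),
    Matrix.conjTranspose_apply, stack, Matrix.of_apply]
  exact Finset.sum_congr rfl fun b _ => Finset.sum_congr rfl fun d _ => mul_comm _ _

lemma stack_mul_conjTranspose {D : Type} [Fintype D] [DecidableEq D] (N : KrausFamily A B)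
    (s : Matrix A D ℂ) (b b' : B) (d d' : D) :
    (N.stack s * (N.stack s)ᴴ) (b, d) (b', d') =
      N.apply (s * Matrix.single d d' (1 : ℂ) * sᴴ) b b' := by
  rw [apply, Matrix.sum_apply, Matrix.mul_apply]
  refine Finset.sum_congr rfl fun i _ => ?_
  have h : N.K i * (s * Matrix.single d d' (1 : ℂ) * sᴴ) * (N.K i)ᴴ =
      N.K i * s * Matrix.single d d' (1 : ℂ) * (N.K i * s)ᴴ := by
    simp only [Matrix.conjTranspose_mul, Matrix.mul_assoc]
  rw [h, Matrix.mul_apply, Finset.sum_eq_single d']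
  · simp [stack]
  · intro x _ hx
    rw [Matrix.mul_single_apply_of_ne _ _ _ _ _ hx, zero_mul]
  · simp

lemma _root_.Matrix.PosSemidef.exists_eq_mul_conjTranspose {σ : Matrix A A ℂ}
    (h : σ.PosSemidef) : ∃ (m : ℕ) (s : Matrix A (Fin m) ℂ), σ = s * sᴴ := by
  obtain ⟨m, v, rfl⟩ := Matrix.posSemidef_iff_eq_sum_vecMulVec.1 h
  refine ⟨m, Matrix.of fun a x => v x a, ?_⟩
  ext a a'
  simp [Matrix.sum_apply, Matrix.mul_apply, Matrix.vecMulVec_apply]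

lemma compl_posSemidef (N : KrausFamily A B) {σ : Matrix A A ℂ} (h : σ.PosSemidef) :
    (N.compl σ).PosSemidef := by
  obtain ⟨m, s, rfl⟩ := h.exists_eq_mul_conjTranspose
  rw [compl_mul_conjTranspose]
  exact (Matrix.posSemidef_conjTranspose_mul_self _).transpose

/-- The entropy of the complementary output depends only on the channel, not on the chosen
Kraus operators. -/
lemma vnEntropy_compl_congr {N M : KrausFamily A B} (hNM : ∀ ρ, N.apply ρ = M.apply ρ)
    {σ : Matrix A A ℂ} (h : σ.PosSemidef) :
    vnEntropy (N.compl σ) = vnEntropy (M.compl σ) := by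
  obtain ⟨m, s, rfl⟩ := h.exists_eq_mul_conjTranspose
  rw [compl_mul_conjTranspose, compl_mul_conjTranspose,
    vnEntropy_transpose (Matrix.isHermitian_conjTranspose_mul_self _),
    vnEntropy_transpose (Matrix.isHermitian_conjTranspose_mul_self _),
    ← vnEntropy_mul_conjTranspose, ← vnEntropy_mul_conjTranspose]
  congr 1
  ext ⟨b, d⟩ ⟨b', d'⟩
  rw [stack_mul_conjTranspose, stack_mul_conjTranspose, hNM]

lemma apply_vecMulVec (N : KrausFamily A B) (v : A → ℂ) (b b' : B) :
    N.apply (Matrix.vecMulVec v (star v)) b b' =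
      ∑ i, (N.K i *ᵥ v) b * star ((N.K i *ᵥ v) b') := by
  rw [apply, Matrix.sum_apply]
  refine Finset.sum_congr rfl fun i _ => ?_
  rw [Matrix.mul_vecMulVec, Matrix.vecMulVec_mul, ← Matrix.star_mulVec]
  rfl

lemma compl_vecMulVec (N : KrausFamily A B) (v : A → ℂ) (i j : N.ι) :
    N.compl (Matrix.vecMulVec v (star v)) i j =
      ∑ b, (N.K i *ᵥ v) b * star ((N.K j *ᵥ v) b) := by
  rw [compl, Matrix.of_apply, Matrix.mul_vecMulVec, Matrix.vecMulVec_mul, ← Matrix.star_mulVec]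
  rfl

/-- On pure inputs, output and complementary output have the same entropy. -/
lemma vnEntropy_compl_vecMulVec (N : KrausFamily A B) (v : A → ℂ) :
    vnEntropy (N.compl (Matrix.vecMulVec v (star v))) =
      vnEntropy (N.apply (Matrix.vecMulVec v (star v))) := by
  let G : Matrix B N.ι ℂ := Matrix.of fun b i => (N.K i *ᵥ v) b
  have h1 : N.apply (Matrix.vecMulVec v (star v)) = G * Gᴴ := by
    ext b b'
    rw [apply_vecMulVec, Matrix.mul_apply]
    rfl
  have h2 : N.compl (Matrix.vecMulVec v (star v)) = (Gᴴ * G)ᵀ := by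
    ext i j
    rw [compl_vecMulVec, Matrix.transpose_apply, Matrix.mul_apply]
    exact Finset.sum_congr rfl fun b _ => mul_comm _ _
  rw [h1, h2, vnEntropy_transpose (Matrix.isHermitian_conjTranspose_mul_self _),
    vnEntropy_mul_conjTranspose]

/-- The matrix entries of a channel as a superoperator. -/
noncomputable def coeff (N : KrausFamily A B) (b b' : B) (a a' : A) : ℂ :=
  ∑ i, N.K i b a * star (N.K i b' a')

/-- The matrix entries of the complementary channel as a superoperator. -/
noncomputable def complCoeff (N : KrausFamily A B) (i j : N.ι) (a a' : A) : ℂ :=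
  ∑ b, N.K i b a * star (N.K j b a')

lemma _root_.Matrix.mul_mul_conjTranspose_apply {D : Type*} (K L : Matrix D A ℂ)
    (ρ : Matrix A A ℂ) (d d' : D) :
    (K * ρ * Lᴴ) d d' = ∑ a, ∑ a', K d a * star (L d' a') * ρ a a' := by
  simp only [Matrix.mul_apply, Matrix.conjTranspose_apply, Finset.sum_mul]
  rw [Finset.sum_comm]
  exact Finset.sum_congr rfl fun a _ => Finset.sum_congr rfl fun a' _ => by ring

lemma apply_eq_sum_coeff (N : KrausFamily A B) (ρ : Matrix A A ℂ) (b b' : B) :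
    N.apply ρ b b' = ∑ a, ∑ a', N.coeff b b' a a' * ρ a a' := by
  simp only [apply, Matrix.sum_apply, Matrix.mul_mul_conjTranspose_apply, coeff, Finset.sum_mul]
  rw [Finset.sum_comm]
  exact Finset.sum_congr rfl fun a _ => Finset.sum_comm

lemma compl_eq_sum_complCoeff (N : KrausFamily A B) (ρ : Matrix A A ℂ) (i j : N.ι) :
    N.compl ρ i j = ∑ a, ∑ a', N.complCoeff i j a a' * ρ a a' := by
  simp only [compl, Matrix.of_apply, Matrix.trace, Matrix.diag_apply,
    Matrix.mul_mul_conjTranspose_apply, complCoeff, Finset.sum_mul]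
  rw [Finset.sum_comm]
  exact Finset.sum_congr rfl fun a _ => Finset.sum_comm

lemma _root_.sum_sum_mul_single (F : A → A → ℂ) (a a' : A) :
    ∑ x, ∑ y, F x y * Matrix.single a a' (1 : ℂ) x y = F a a' := by
  simp [Matrix.single_apply, ite_and]

lemma apply_single (N : KrausFamily A B) (a a' : A) (b b' : B) :
    N.apply (Matrix.single a a' 1) b b' = N.coeff b b' a a' := by
  rw [apply_eq_sum_coeff, sum_sum_mul_single]

lemma compl_single (N : KrausFamily A B) (a a' : A) (i j : N.ι) :
    N.compl (Matrix.single a a' 1) i j = N.complCoeff i j a a' := by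
  rw [compl_eq_sum_complCoeff, sum_sum_mul_single]

lemma apply_apply_eq_sum_coeff (R : KrausFamily B C) (T : KrausFamily A B)
    (ρ : Matrix A A ℂ) (c c' : C) :
    R.apply (T.apply ρ) c c' =
      ∑ a, ∑ a', (∑ b, ∑ b', R.coeff c c' b b' * T.coeff b b' a a') * ρ a a' := by
  simp only [apply_eq_sum_coeff, Finset.mul_sum, Finset.sum_mul]
  rw [Finset.sum_congr rfl fun b _ => Finset.sum_comm, Finset.sum_comm]
  refine Finset.sum_congr rfl fun a _ => ?_
  rw [Finset.sum_congr rfl fun b _ => Finset.sum_comm, Finset.sum_comm]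
  simp only [mul_assoc]

lemma _root_.Fintype.sum_prod_pi {D : Type} [Fintype D] {n : ℕ} (F : Fin n → D → ℂ) :
    ∑ f : Fin n → D, ∏ k, F k (f k) = ∏ k, ∑ d, F k d := by
  classical
  rw [Finset.prod_univ_sum, Fintype.piFinset_univ]

lemma _root_.Fintype.sum_sum_prod_pi {D E : Type} [Fintype D] [Fintype E] {n : ℕ}
    (F : Fin n → D → E → ℂ) :
    ∑ f : Fin n → D, ∑ g : Fin n → E, ∏ k, F k (f k) (g k) = ∏ k, ∑ d, ∑ e, F k d e := by
  rw [← Fintype.sum_prod_pi]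
  exact Finset.sum_congr rfl fun f _ => Fintype.sum_prod_pi fun k e => F k (f k) e

lemma coeff_pow (N : KrausFamily A B) (n : ℕ) (b b' : Fin n → B) (a a' : Fin n → A) :
    (N.pow n).coeff b b' a a' = ∏ k, N.coeff (b k) (b' k) (a k) (a' k) := by
  unfold coeff
  rw [← Fintype.sum_prod_pi]
  refine Finset.sum_congr rfl fun f _ => ?_
  rw [Finset.prod_mul_distrib, ← star_prod]
  rfl

lemma complCoeff_pow (N : KrausFamily A B) (n : ℕ) (i j : Fin n → N.ι) (a a' : Fin n → A) :
    (N.pow n).complCoeff i j a a' = ∏ k, N.complCoeff (i k) (j k) (a k) (a' k) := by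
  unfold complCoeff
  rw [← Fintype.sum_prod_pi]
  refine Finset.sum_congr rfl fun f _ => ?_
  rw [Finset.prod_mul_distrib, ← star_prod]
  rfl

lemma isChannel_iff (N : KrausFamily A B) : N.IsChannel ↔
    ∀ a a', ∑ i, ∑ b, star (N.K i b a) * N.K i b a' = if a = a' then 1 else 0 := by
  rw [IsChannel, ← Matrix.ext_iff]
  simp [Matrix.sum_apply, Matrix.mul_apply, Matrix.one_apply]

lemma IsChannel.pow {N : KrausFamily A B} (hN : N.IsChannel) (n : ℕ) : (N.pow n).IsChannel := by
  rw [isChannel_iff] at hN ⊢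
  intro a a'
  have h : ∏ k, ∑ i, ∑ b, star (N.K i b (a k)) * N.K i b (a' k) =
      if a = a' then (1 : ℂ) else 0 := by
    simp only [hN, Finset.prod_boole, Finset.mem_univ, true_imp_iff, funext_iff]
  rw [← h, ← Fintype.sum_sum_prod_pi]
  refine Finset.sum_congr rfl fun f _ => Finset.sum_congr rfl fun b _ => ?_
  rw [Finset.prod_mul_distrib, ← star_prod]
  rfl

lemma sum_sum_coeff_pow (R : KrausFamily B C) (T : KrausFamily A B) (n : ℕ)
    (c c' : Fin n → C) (a a' : Fin n → A) :
    ∑ b, ∑ b', (R.pow n).coeff c c' b b' * (T.pow n).coeff b b' a a' =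
      ∏ k, ∑ b, ∑ b', R.coeff (c k) (c' k) b b' * T.coeff b b' (a k) (a' k) := by
  rw [← Fintype.sum_sum_prod_pi]
  simp only [coeff_pow, Finset.prod_mul_distrib]

lemma pow_apply_of_comp {N : KrausFamily A C} {R : KrausFamily B C} {T : KrausFamily A B}
    (h : ∀ ρ, N.apply ρ = R.apply (T.apply ρ)) (n : ℕ) (ρ : Matrix (Fin n → A) (Fin n → A) ℂ) :
    (N.pow n).apply ρ = (R.pow n).apply ((T.pow n).apply ρ) := by
  have hc : ∀ c c' a a', N.coeff c c' a a' =
      ∑ b, ∑ b', R.coeff c c' b b' * T.coeff b b' a a' := by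
    intro c c' a a'
    rw [← apply_single, h, apply_apply_eq_sum_coeff, sum_sum_mul_single]
  ext c c'
  rw [apply_eq_sum_coeff, apply_apply_eq_sum_coeff]
  refine Finset.sum_congr rfl fun a _ => Finset.sum_congr rfl fun a' _ => ?_
  rw [sum_sum_coeff_pow, coeff_pow]
  simp only [hc]

lemma IsDegradable.pow {T : KrausFamily A B} (h : T.IsDegradable) (n : ℕ) :
    (T.pow n).IsDegradable := by
  obtain ⟨D, hD, h⟩ := h
  have hc : ∀ i j a a', T.complCoeff i j a a' =
      ∑ b, ∑ b', D.coeff i j b b' * T.coeff b b' a a' := by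
    intro i j a a'
    rw [← compl_single, ← h, apply_apply_eq_sum_coeff, sum_sum_mul_single]
  refine ⟨D.pow n, hD.pow n, fun ρ => ?_⟩
  ext i j
  rw [compl_eq_sum_complCoeff]
  refine (apply_apply_eq_sum_coeff _ _ _ _ _).trans ?_
  refine Finset.sum_congr rfl fun a _ => Finset.sum_congr rfl fun a' _ => ?_
  refine congrArg (· * ρ a a') ((sum_sum_coeff_pow D T n i j a a').trans ?_)
  refine .trans ?_ (complCoeff_pow T n i j a a').symm
  simp only [hc]

end KrausFamily

end Channels

section Capacity

/-- For degradable channels the output entropy is at least the complementary output entropy. -/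
lemma KrausFamily.IsDegradable.vnEntropy_compl_le {T : KrausFamily A B} (h : T.IsDegradable)
    {σ : Matrix A A ℂ} (hσ : σ.PosSemidef) :
    vnEntropy (T.compl σ) ≤ vnEntropy (T.apply σ) := by
  obtain ⟨m, v, rfl⟩ := Matrix.posSemidef_iff_eq_sum_vecMulVec.1 hσ
  obtain ⟨D, hD, h⟩ := h
  have h1 := holevo_apply_le D hD (ρ := fun x => T.apply (Matrix.vecMulVec (v x) (star (v x))))
    fun x => T.apply_posSemidef (Matrix.posSemidef_vecMulVec_self_star _)
  simp only [← T.apply_sum, h, T.vnEntropy_compl_vecMulVec] at h1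
  linarith

lemma KrausFamily.cohInfo_le {T : KrausFamily A B} (hT : T.IsChannel) {φ : Matrix A A ℂ}
    (hφ : IsDensity φ) : cohInfo T φ ≤ Real.logb 2 (Fintype.card B) := by
  have h1 : IsDensity (T.apply φ) :=
    ⟨T.apply_posSemidef hφ.1, (T.trace_apply hT φ).trans hφ.2⟩
  have h2 : IsDensity (T.compl φ) :=
    ⟨T.compl_posSemidef hφ.1, (T.trace_compl φ).trans h1.2⟩
  have := h1.vnEntropy_le
  have := h2.vnEntropy_nonneg
  unfold cohInfo
  linarith

lemma KrausFamily.cohInfo_le_Q1 {T : KrausFamily A B} (hT : T.IsChannel) {φ : Matrix A A ℂ}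
    (hφ : IsDensity φ) : cohInfo T φ ≤ Q1 T := by
  refine le_csSup ⟨Real.logb 2 (Fintype.card B), ?_⟩ ⟨φ, hφ, rfl⟩
  rintro _ ⟨ψ, hψ, rfl⟩
  exact cohInfo_le hT hψ

lemma logb_two_natCast_nonneg (n : ℕ) : 0 ≤ Real.logb 2 n := by
  rcases Nat.eq_zero_or_pos n with rfl | h
  · simp
  · exact Real.logb_nonneg one_lt_two (by exact_mod_cast h)

lemma KrausFamily.Q1_le {T : KrausFamily A B} (hT : T.IsChannel) :
    Q1 T ≤ Real.logb 2 (Fintype.card B) := by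
  refine Real.sSup_le ?_ (logb_two_natCast_nonneg _)
  rintro _ ⟨ψ, hψ, rfl⟩
  exact cohInfo_le hT hψ

lemma KrausFamily.IsDegradable.Q1_nonneg {T : KrausFamily A B} (h : T.IsDegradable) :
    0 ≤ Q1 T := by
  refine Real.sSup_nonneg ?_
  rintro _ ⟨ψ, hψ, rfl⟩
  exact sub_nonneg.2 (h.vnEntropy_compl_le hψ.1)

lemma KrausFamily.Q1_pow_le_Qcap {T : KrausFamily A B} (hT : T.IsChannel) {n : ℕ}
    (hn : 0 < n) : 1 / (n : ℝ) * Q1 (T.pow n) ≤ Qcap T := by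
  refine le_csSup ⟨Real.logb 2 (Fintype.card B), ?_⟩ ⟨n, hn, rfl⟩
  rintro _ ⟨m, hm, rfl⟩
  have h := Q1_le (hT.pow m)
  rw [Fintype.card_fun, Fintype.card_fin, Nat.cast_pow, Real.logb_pow] at h
  have hm' : (0 : ℝ) < m := by exact_mod_cast hm
  rw [one_div, inv_mul_le_iff₀ hm']
  exact h

variable {B' : Type} [Fintype B'] [DecidableEq B']

/-- The difference of Holevo quantities of channel and environment outputs is bounded by the
coherent information of any degradable channel from which the channel is obtained by
postprocessing. -/
lemma holevo_sub_holevo_le_cohInfo {N : KrausFamily A B} {T : KrausFamily A B'}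
    {R : KrausFamily B' B} (hR : R.IsChannel)
    (hcomp : ∀ ρ : Matrix A A ℂ, N.apply ρ = R.apply (T.apply ρ)) (hdeg : T.IsDegradable)
    {τ : Type*} [Fintype τ] {σ : τ → Matrix A A ℂ} (hσ : ∀ t, (σ t).PosSemidef) :
    (vnEntropy (N.apply (∑ t, σ t)) - ∑ t, vnEntropy (N.apply (σ t))) -
      (vnEntropy (N.compl (∑ t, σ t)) - ∑ t, vnEntropy (N.compl (σ t))) ≤
      cohInfo T (∑ t, σ t) := by
  have hs : (∑ t, σ t).PosSemidef := Matrix.posSemidef_sum _ fun t _ => hσ t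
  have h1 := holevo_apply_le R hR (ρ := fun t => T.apply (σ t))
    fun t => T.apply_posSemidef (hσ t)
  simp only [← T.apply_sum, ← hcomp] at h1
  have hc : ∀ ρ, N.apply ρ = (R.comp T).apply ρ := fun ρ => by
    rw [hcomp, KrausFamily.comp_apply]
  have h2 := holevo_apply_le (KrausFamily.traceLeft R.ι T.ι)
    (KrausFamily.traceLeft_isChannel _ _) (ρ := fun t => (R.comp T).compl (σ t))
    fun t => (R.comp T).compl_posSemidef (hσ t)
  have e : ∀ ρ, (KrausFamily.traceLeft R.ι T.ι).apply ((R.comp T).compl ρ) = T.compl ρ :=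
    R.traceLeft_comp_compl hR T
  have e' : ∑ t, (R.comp T).compl (σ t) = (R.comp T).compl (∑ t, σ t) :=
    ((R.comp T).compl_sum _ _).symm
  have h3 : vnEntropy (T.compl (∑ t, σ t)) - ∑ t, vnEntropy (T.compl (σ t)) ≤
      vnEntropy (N.compl (∑ t, σ t)) - ∑ t, vnEntropy (N.compl (σ t)) := by
    rw [KrausFamily.vnEntropy_compl_congr hc hs,
      Finset.sum_congr rfl fun t _ => KrausFamily.vnEntropy_compl_congr hc (hσ t)]
    rw [← e (∑ t, σ t), ← Finset.sum_congr rfl fun t _ => congrArg vnEntropy (e (σ t)), ← e']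
    exact h2
  have h4 : ∑ t, vnEntropy (T.compl (σ t)) ≤ ∑ t, vnEntropy (T.apply (σ t)) :=
    Finset.sum_le_sum fun t _ => hdeg.vnEntropy_compl_le (hσ t)
  unfold cohInfo
  linarith

section Ensemble

variable {nX nT : ℕ} (p : Fin nX → ℝ) (φ : Fin nX → (A → ℂ)) (pt : Fin nT → Fin nX → ℝ)

/-- The subnormalised input state conditioned on the classical outcome `t`. -/
noncomputable def condState (t : Fin nT) : Matrix A A ℂ :=
  ∑ x, ((pt t x * p x : ℝ) : ℂ) • Matrix.vecMulVec (φ x) (star (φ x))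

lemma condState_posSemidef (hp : ∀ x, 0 ≤ p x) (hpt : ∀ t x, 0 ≤ pt t x) (t : Fin nT) :
    (condState p φ pt t).PosSemidef :=
  Matrix.posSemidef_sum _ fun x _ => (Matrix.posSemidef_vecMulVec_self_star _).smul
    (Complex.zero_le_real.2 (mul_nonneg (hpt t x) (hp x)))

lemma isDensity_sum_condState (hp : ∀ x, 0 ≤ p x) (hp1 : ∑ x, p x = 1)
    (hφ : ∀ x, ∑ a, ‖φ x a‖ ^ 2 = 1) (hpt : ∀ t x, 0 ≤ pt t x)
    (hpt1 : ∀ x, ∑ t, pt t x = 1) : IsDensity (∑ t, condState p φ pt t) := by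
  refine ⟨Matrix.posSemidef_sum _ fun t _ => condState_posSemidef p φ pt hp hpt t, ?_⟩
  have h1 : ∀ x, (Matrix.vecMulVec (φ x) (star (φ x))).trace = 1 := by
    intro x
    rw [← Complex.ofReal_one, ← hφ x, Matrix.trace, Complex.ofReal_sum]
    refine Finset.sum_congr rfl fun a _ => ?_
    rw [Matrix.diag_apply, Matrix.vecMulVec_apply, Pi.star_apply, Complex.star_def,
      Complex.mul_conj, Complex.sq_norm]
  simp only [condState, Matrix.trace_sum, Matrix.trace_smul, h1, smul_eq_mul, mul_one]
  rw [Finset.sum_comm]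
  simp only [← Complex.ofReal_sum, ← Finset.sum_mul, hpt1, one_mul, hp1, Complex.ofReal_one]

variable (N : KrausFamily A B)

lemma apply_condState (t : Fin nT) (b b' : B) :
    N.apply (condState p φ pt t) b b' = ∑ e, ∑ x, ((pt t x * p x : ℝ) : ℂ) *
      ((N.K e *ᵥ φ x) b * star ((N.K e *ᵥ φ x) b')) := by
  have h : ∀ (c : ℂ) (ρ : Matrix A A ℂ), N.apply (c • ρ) = c • N.apply ρ := by
    intro c ρ
    simp [KrausFamily.apply, Finset.smul_sum]
  rw [condState, N.apply_sum, Matrix.sum_apply, Finset.sum_comm]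
  refine Finset.sum_congr rfl fun x _ => ?_
  rw [h, Matrix.smul_apply, N.apply_vecMulVec, smul_eq_mul, Finset.mul_sum]

lemma compl_condState (t : Fin nT) (i j : N.ι) :
    N.compl (condState p φ pt t) i j = ∑ b, ∑ x, ((pt t x * p x : ℝ) : ℂ) *
      ((N.K i *ᵥ φ x) b * star ((N.K j *ᵥ φ x) b)) := by
  have h : ∀ (c : ℂ) (ρ : Matrix A A ℂ), N.compl (c • ρ) = c • N.compl ρ := by
    intro c ρ
    ext i j
    simp [KrausFamily.compl]
  rw [condState, N.compl_sum, Matrix.sum_apply, Finset.sum_comm]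
  refine Finset.sum_congr rfl fun x _ => ?_
  rw [h, Matrix.smul_apply, N.compl_vecMulVec, smul_eq_mul, Finset.mul_sum]

lemma red12_privState (t : Fin nT) (b : B) (t' : Fin nT) (b' : B) :
    red12 (privState N p φ pt) (t, b) (t', b') =
      if t = t' then N.apply (condState p φ pt t) b b' else 0 := by
  by_cases h : t = t'
  · simp [red12, privState, h, apply_condState]
  · simp [red12, privState, h]

lemma red13_privState (t : Fin nT) (i : N.ι) (t' : Fin nT) (j : N.ι) :
    red13 (privState N p φ pt) (t, i) (t', j) =
      if t = t' then N.compl (condState p φ pt t) i j else 0 := by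
  by_cases h : t = t'
  · simp [red13, privState, h, compl_condState]
  · simp [red13, privState, h]

lemma red2_privState : red2 (privState N p φ pt) = N.apply (∑ t, condState p φ pt t) := by
  ext b b'
  rw [N.apply_sum, Matrix.sum_apply]
  simp [red2, privState, apply_condState]

lemma red3_privState : red3 (privState N p φ pt) = N.compl (∑ t, condState p φ pt t) := by
  ext i j
  rw [N.compl_sum, Matrix.sum_apply]
  simp [red3, privState, compl_condState]

end Ensemble

/-- The one-shot private information is bounded by the one-shot quantum capacity of any
degradable channel from which the channel is obtained by postprocessing. -/
lemma Cp1_le_Q1 {N : KrausFamily A B} {T : KrausFamily A B'} {R : KrausFamily B' B}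
    (hT : T.IsChannel) (hR : R.IsChannel)
    (hcomp : ∀ ρ : Matrix A A ℂ, N.apply ρ = R.apply (T.apply ρ)) (hdeg : T.IsDegradable) :
    Cp1 N ≤ Q1 T := by
  refine Real.sSup_le ?_ hdeg.Q1_nonneg
  rintro _ ⟨nX, nT, p, φ, pt, hp, hp1, hφ, hpt, hpt1, rfl⟩
  have hσ := condState_posSemidef p φ pt hp hpt
  have h := (holevo_sub_holevo_le_cohInfo hR hcomp hdeg hσ).trans
    (KrausFamily.cohInfo_le_Q1 hT (isDensity_sum_condState p φ pt hp hp1 hφ hpt hpt1))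
  rw [vnEntropy_block (fun t => (N.apply_posSemidef (hσ t)).1) (red12_privState p φ pt N),
    vnEntropy_block (fun t => (N.compl_posSemidef (hσ t)).1) (red13_privState p φ pt N),
    red2_privState, red3_privState]
  linarith

end Capacity

/-- If `T` is a degradable extension of the quantum channel `N`
(an additive extension of `N` that is degradable), then `C_p(N) ≤ Q^{(1)}(T)`. -/
theorem private_capacity_le_of_degradable_extension
    {A B B' : Type} [Fintype A] [DecidableEq A] [Fintype B] [DecidableEq B]
    [Fintype B'] [DecidableEq B']
    (N : KrausFamily A B) (T : KrausFamily A B') (R : KrausFamily B' B)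
    (hN : N.IsChannel) (hT : T.IsChannel) (hR : R.IsChannel)
    (hcomp : ∀ ρ : Matrix A A ℂ, N.apply ρ = R.apply (T.apply ρ))
    (hadd : Qcap T = Q1 T)
    (hdeg : T.IsDegradable) :
    Cp N ≤ Q1 T := by
  refine Real.sSup_le ?_ hdeg.Q1_nonneg
  rintro _ ⟨n, hn, rfl⟩
  rw [← hadd]
  refine le_trans ?_ (KrausFamily.Q1_pow_le_Qcap hT hn)
  exact mul_le_mul_of_nonneg_left (Cp1_le_Q1 (hT.pow n) (hR.pow n)
    (KrausFamily.pow_apply_of_comp hcomp n) (hdeg.pow n)) (by positivity)
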